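/- Let A be a fanning frame with horizontal derivative H(t). (1) If X : ℝ → Matrix (Fin n) (Fin n) ℝ is smooth with X(t) invertible for every t, then the horizontal derivative of the fanning frame t ↦ A(t)X(t) is H(t)X(t). (2) If T is an invertible (kn)×(kn) real matrix, then the horizontal derivative of the fanning frame t ↦ T·A(t) is T·H(t). -/

import Mathlib

open Matrix

noncomputable def mderiv {M N : ℕ} (A : ℝ → Matrix (Fin M) (Fin N) ℝ) :
    ℝ → Matrix (Fin M) (Fin N) ℝ :=
  fun t => Matrix.of fun i j => deriv (fun s => A s i j) t

noncomputable def dmat {M N : ℕ} (i : ℕ) (A : ℝ → Matrix (Fin M) (Fin N) ℝ) :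
    ℝ → Matrix (Fin M) (Fin N) ℝ :=
  mderiv^[i] A

def MatSmooth {M N : ℕ} (A : ℝ → Matrix (Fin M) (Fin N) ℝ) : Prop :=
  ∀ i j, ContDiff ℝ (⊤ : ℕ∞) fun t => A t i j

def juxt (k n : ℕ) (B : Fin k → Matrix (Fin (k * n)) (Fin n) ℝ) :
    Matrix (Fin (k * n)) (Fin (k * n)) ℝ :=
  Matrix.of fun r c => B (finProdFinEquiv.symm c).1 r (finProdFinEquiv.symm c).2

noncomputable def frameMat (k n : ℕ) (A : ℝ → Matrix (Fin (k * n)) (Fin n) ℝ) (t : ℝ) :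
    Matrix (Fin (k * n)) (Fin (k * n)) ℝ :=
  juxt k n fun i => dmat (i : ℕ) A t

def IsFanning (k n : ℕ) (A : ℝ → Matrix (Fin (k * n)) (Fin n) ℝ) : Prop :=
  MatSmooth A ∧ ∀ t, IsUnit (frameMat k n A t)

def IsCoeffs (k n : ℕ) (A : ℝ → Matrix (Fin (k * n)) (Fin n) ℝ)
    (P : ℕ → ℝ → Matrix (Fin n) (Fin n) ℝ) : Prop :=
  (∀ i ∈ Finset.Icc 1 k, MatSmooth (P i)) ∧
  ∀ t, dmat k A t + ∑ i ∈ Finset.Icc 1 k, (k.choose i : ℝ) • (dmat (k - i) A t * P i t) = 0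

noncomputable def Nmat (k n : ℕ) : Matrix (Fin (k * n)) (Fin (k * n)) ℝ :=
  Matrix.of fun r c =>
    if ((finProdFinEquiv.symm c).1 : ℕ) = ((finProdFinEquiv.symm r).1 : ℕ) + 1 ∧
        (finProdFinEquiv.symm c).2 = (finProdFinEquiv.symm r).2 then
      (((finProdFinEquiv.symm r).1 : ℕ) + 1 : ℝ)
    else 0

noncomputable def fundEnd (k n : ℕ) (A : ℝ → Matrix (Fin (k * n)) (Fin n) ℝ) (t : ℝ) :
    Matrix (Fin (k * n)) (Fin (k * n)) ℝ :=
  frameMat k n A t * Nmat k n * (frameMat k n A t)⁻¹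

noncomputable def fundRefl (k n : ℕ) (A : ℝ → Matrix (Fin (k * n)) (Fin n) ℝ) (t : ℝ) :
    Matrix (Fin (k * n)) (Fin (k * n)) ℝ :=
  (k : ℝ)⁻¹ • ((2 : ℝ) • mderiv (fundEnd k n A) t - ((k : ℝ) - 2) • (1 : Matrix (Fin (k * n)) (Fin (k * n)) ℝ))

noncomputable def fundProj (k n : ℕ) (A : ℝ → Matrix (Fin (k * n)) (Fin n) ℝ) (t : ℝ) :
    Matrix (Fin (k * n)) (Fin (k * n)) ℝ :=
  (2 : ℝ)⁻¹ • ((1 : Matrix (Fin (k * n)) (Fin (k * n)) ℝ) - fundRefl k n A t)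

noncomputable def horDer (k n : ℕ) (A : ℝ → Matrix (Fin (k * n)) (Fin n) ℝ)
    (P : ℕ → ℝ → Matrix (Fin n) (Fin n) ℝ) (t : ℝ) : Matrix (Fin (k * n)) (Fin n) ℝ :=
  dmat (k - 1) A t + ∑ i ∈ Finset.Icc 1 (k - 1), ((k - 1).choose i : ℝ) • (dmat (k - 1 - i) A t * P i t)

noncomputable def jacobiEnd (k n : ℕ) (A : ℝ → Matrix (Fin (k * n)) (Fin n) ℝ) (t : ℝ) :
    Matrix (Fin (k * n)) (Fin (k * n)) ℝ :=
  (((k : ℝ)) ^ 2)⁻¹ • (mderiv (mderiv (fundEnd k n A)) t * mderiv (mderiv (fundEnd k n A)) t)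

theorem dmat_apply {M N : ℕ} (A : ℝ → Matrix (Fin M) (Fin N) ℝ) (m : ℕ) (t : ℝ)
    (r : Fin M) (c : Fin N) : dmat m A t r c = iteratedDeriv m (fun s => A s r c) t := by
  induction m generalizing t with
  | zero => simp [dmat]
  | succ m ih =>
    have h : dmat (m + 1) A = mderiv (dmat m A) := Function.iterate_succ_apply' _ _ _
    rw [h, iteratedDeriv_succ]
    simp only [mderiv, Matrix.of_apply, ih]

theorem MatSmooth.mul {L M N : ℕ} {A : ℝ → Matrix (Fin L) (Fin M) ℝ}
    {B : ℝ → Matrix (Fin M) (Fin N) ℝ} (hA : MatSmooth A) (hB : MatSmooth B) :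
    MatSmooth fun t => A t * B t := by
  intro i j
  simp only [Matrix.mul_apply]
  exact ContDiff.sum fun l _ => (hA i l).mul (hB l j)

theorem MatSmooth.det {N : ℕ} {X : ℝ → Matrix (Fin N) (Fin N) ℝ} (hX : MatSmooth X) :
    ContDiff ℝ (⊤ : ℕ∞) fun t => (X t).det := by
  simp only [Matrix.det_apply']
  exact ContDiff.sum fun σ _ => contDiff_const.mul (contDiff_prod fun i _ => hX _ _)

theorem MatSmooth.inv {N : ℕ} {X : ℝ → Matrix (Fin N) (Fin N) ℝ} (hX : MatSmooth X)
    (hu : ∀ t, IsUnit (X t)) : MatSmooth fun t => (X t)⁻¹ := by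
  have hdet : ∀ t, (X t).det ≠ 0 := fun t =>
    ((Matrix.isUnit_iff_isUnit_det _).1 (hu t)).ne_zero
  intro i j
  simp only [Matrix.inv_def, Ring.inverse_eq_inv', Matrix.smul_apply, smul_eq_mul,
    Matrix.adjugate_apply]
  refine (hX.det.inv hdet).mul (MatSmooth.det fun a b => ?_)
  by_cases h : a = j
  · subst h
    simpa using contDiff_const
  · simpa [Matrix.updateRow_ne h] using hX a b

/-- The Leibniz rule for matrix products. -/
theorem dmat_mul {L M N : ℕ} {A : ℝ → Matrix (Fin L) (Fin M) ℝ}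
    {B : ℝ → Matrix (Fin M) (Fin N) ℝ} (hA : MatSmooth A) (hB : MatSmooth B) (m : ℕ) (t : ℝ) :
    dmat m (fun s => A s * B s) t =
      ∑ i ∈ Finset.range (m + 1), (m.choose i : ℝ) • (dmat i A t * dmat (m - i) B t) := by
  have hA' : ∀ i j, ContDiffAt ℝ m (fun t => A t i j) t := fun i j =>
    (hA i j).contDiffAt.of_le (mod_cast le_top)
  have hB' : ∀ i j, ContDiffAt ℝ m (fun t => B t i j) t := fun i j =>
    (hB i j).contDiffAt.of_le (mod_cast le_top)
  ext r c
  rw [dmat_apply]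
  simp only [Matrix.mul_apply, Matrix.sum_apply, Matrix.smul_apply, dmat_apply, smul_eq_mul,
    Finset.mul_sum]
  rw [iteratedDeriv_fun_sum fun l _ => (hA' r l).mul (hB' l c), Finset.sum_comm]
  refine Finset.sum_congr rfl fun l _ => ?_
  rw [iteratedDeriv_fun_mul (hA' r l) (hB' l c)]
  simp only [mul_assoc]

theorem dmat_const_mul {L M N : ℕ} (T : Matrix (Fin L) (Fin M) ℝ)
    {A : ℝ → Matrix (Fin M) (Fin N) ℝ} (hA : MatSmooth A) (m : ℕ) (t : ℝ) :
    dmat m (fun s => T * A s) t = T * dmat m A t := by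
  have hA' : ∀ i j, ContDiffAt ℝ m (fun t => A t i j) t := fun i j =>
    (hA i j).contDiffAt.of_le (mod_cast le_top)
  ext r c
  rw [dmat_apply]
  simp only [Matrix.mul_apply, dmat_apply]
  rw [iteratedDeriv_fun_sum fun l _ => contDiffAt_const.mul (hA' l c)]
  exact Finset.sum_congr rfl fun l _ => iteratedDeriv_const_mul_field _ _

theorem juxt_mul (k n : ℕ) {N : Type*} (B : Fin k → Matrix (Fin (k * n)) (Fin n) ℝ)
    (M : Fin k → Matrix (Fin n) N ℝ) :
    juxt k n B * (Matrix.of fun (r : Fin (k * n)) (c : N) =>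
      M (finProdFinEquiv.symm r).1 (finProdFinEquiv.symm r).2 c) =
      ∑ i, B i * M i := by
  ext r c
  simp only [Matrix.mul_apply, Matrix.sum_apply, juxt, Matrix.of_apply]
  rw [← finProdFinEquiv.sum_comp, Fintype.sum_prod_type]
  simp

theorem frameMat_mul {k n : ℕ} {A : ℝ → Matrix (Fin (k * n)) (Fin n) ℝ}
    {X : ℝ → Matrix (Fin n) (Fin n) ℝ} (hA : MatSmooth A) (hX : MatSmooth X) (t : ℝ) :
    ∃ V, frameMat k n (fun s => A s * X s) t = frameMat k n A t * V := by
  refine ⟨Matrix.of fun r c =>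
    (((finProdFinEquiv.symm c).1 : ℕ).choose (finProdFinEquiv.symm r).1 : ℝ) *
      dmat ((finProdFinEquiv.symm c).1 - (finProdFinEquiv.symm r).1) X t
        (finProdFinEquiv.symm r).2 (finProdFinEquiv.symm c).2, ?_⟩
  have h := juxt_mul k n (fun i => dmat (i : ℕ) A t) fun i => Matrix.of fun a (c : Fin (k * n)) =>
    (((finProdFinEquiv.symm c).1 : ℕ).choose i : ℝ) *
      dmat ((finProdFinEquiv.symm c).1 - i) X t a (finProdFinEquiv.symm c).2
  refine Eq.trans ?_ h.symm
  ext r c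
  obtain ⟨⟨j, b⟩, rfl⟩ := finProdFinEquiv.surjective c
  simp only [frameMat, juxt, Matrix.of_apply, Equiv.symm_apply_apply, Matrix.sum_apply,
    Matrix.mul_apply, dmat_mul hA hX, Matrix.smul_apply, smul_eq_mul]
  rw [Finset.sum_subset (Finset.range_subset_range.2 (Nat.succ_le_of_lt j.2)),
    ← Fin.sum_univ_eq_sum_range (n := k)
      (f := fun i => ((j : ℕ).choose i : ℝ) * ∑ l, dmat i A t r l * dmat (j - i) X t l b)]
  · simp only [Finset.mul_sum]
    exact Finset.sum_congr rfl fun i _ => Finset.sum_congr rfl fun l _ => by ring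
  · intro i _ hi
    rw [Nat.choose_eq_zero_of_lt (by simpa using hi)]
    simp

theorem IsFanning.mul_right {k n : ℕ} {A : ℝ → Matrix (Fin (k * n)) (Fin n) ℝ}
    (hA : IsFanning k n A) {X : ℝ → Matrix (Fin n) (Fin n) ℝ} (hX : MatSmooth X)
    (hu : ∀ t, IsUnit (X t)) : IsFanning k n fun t => A t * X t := by
  refine ⟨hA.1.mul hX, fun t => ?_⟩
  obtain ⟨V, hV⟩ := frameMat_mul (hA.1.mul hX) (hX.inv hu) t
  have h : (fun s => A s * X s * (X s)⁻¹) = A := funext fun s =>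
    Matrix.mul_nonsing_inv_cancel_right _ _ ((Matrix.isUnit_iff_isUnit_det _).1 (hu s))
  have hf := hA.2 t
  rw [h] at hV
  rw [hV, Matrix.isUnit_iff_isUnit_det, Matrix.det_mul] at hf
  exact (Matrix.isUnit_iff_isUnit_det _).2 (isUnit_of_mul_isUnit_left hf)

theorem frameMat_const_mul {k n : ℕ} {A : ℝ → Matrix (Fin (k * n)) (Fin n) ℝ}
    (hA : MatSmooth A) (T : Matrix (Fin (k * n)) (Fin (k * n)) ℝ) (t : ℝ) :
    frameMat k n (fun s => T * A s) t = T * frameMat k n A t := by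
  ext r c
  simp [frameMat, juxt, dmat_const_mul T hA, Matrix.mul_apply]

theorem IsFanning.const_mul {k n : ℕ} {A : ℝ → Matrix (Fin (k * n)) (Fin n) ℝ}
    (hA : IsFanning k n A) {T : Matrix (Fin (k * n)) (Fin (k * n)) ℝ} (hT : IsUnit T) :
    IsFanning k n fun t => T * A t := by
  refine ⟨MatSmooth.mul (fun _ _ => contDiff_const) hA.1, fun t => ?_⟩
  rw [frameMat_const_mul hA.1]
  exact hT.mul (hA.2 t)

/-- The blocks `A, A', …, A^{(k-1)}` of a fanning frame are right linearly independent. -/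
theorem eq_zero_of_sum_dmat_mul_eq_zero {k n : ℕ} {A : ℝ → Matrix (Fin (k * n)) (Fin n) ℝ}
    {t : ℝ} (hA : IsUnit (frameMat k n A t)) (M : ℕ → Matrix (Fin n) (Fin n) ℝ)
    (h : ∑ i ∈ Finset.range k, dmat i A t * M i = 0) {i : ℕ} (hi : i < k) : M i = 0 := by
  have h' : frameMat k n A t * (Matrix.of fun (r : Fin (k * n)) (c : Fin n) =>
      M (finProdFinEquiv.symm r).1 (finProdFinEquiv.symm r).2 c) =
      ∑ i : Fin k, dmat (i : ℕ) A t * M i := juxt_mul k n _ fun i => M i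
  rw [Fin.sum_univ_eq_sum_range (fun i => dmat i A t * M i), h] at h'
  have hz := congrArg
    (fun B : Matrix (Fin (k * n)) (Fin n) ℝ => (frameMat k n A t)⁻¹ * B) h'
  simp only [Matrix.mul_zero] at hz
  rw [Matrix.nonsing_inv_mul_cancel_left _ _ ((Matrix.isUnit_iff_isUnit_det _).1 hA)] at hz
  ext a b
  have hab := congrFun (congrFun hz (finProdFinEquiv (⟨i, hi⟩, a))) b
  simpa only [Matrix.of_apply, Equiv.symm_apply_apply, Matrix.zero_apply] using hab

/-- The combination `∑ i ≤ m, C(m,i) A^{(m-i)} R_i` at a point. -/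
noncomputable def binomSum {M N : ℕ} (m : ℕ) (A : ℝ → Matrix (Fin M) (Fin N) ℝ)
    (R : ℕ → Matrix (Fin N) (Fin N) ℝ) (t : ℝ) : Matrix (Fin M) (Fin N) ℝ :=
  ∑ i ∈ Finset.range (m + 1), (m.choose i : ℝ) • (dmat (m - i) A t * R i)

theorem dmat_add_sum_eq_binomSum {M N : ℕ} (m : ℕ) (A : ℝ → Matrix (Fin M) (Fin N) ℝ)
    (P : ℕ → ℝ → Matrix (Fin N) (Fin N) ℝ) (t : ℝ) :
    dmat m A t + ∑ i ∈ Finset.Icc 1 m, (m.choose i : ℝ) • (dmat (m - i) A t * P i t) =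
      binomSum m A (Function.update (fun i => P i t) 0 1) t := by
  rw [binomSum, Finset.sum_range_succ', add_comm, Finset.range_eq_Ico,
    Finset.sum_Ico_add' (fun i => (m.choose i : ℝ) •
      (dmat (m - i) A t * Function.update (fun i => P i t) 0 1 i)) 0 m 1]
  congr 1
  · refine Finset.sum_congr rfl fun i hi => ?_
    have := (Finset.mem_Icc.1 hi).1
    rw [Function.update_of_ne (by omega)]
  · simp

theorem binomSum_congr {M N m : ℕ} (A : ℝ → Matrix (Fin M) (Fin N) ℝ)
    {R S : ℕ → Matrix (Fin N) (Fin N) ℝ} (t : ℝ) (h : ∀ i ≤ m, R i = S i) :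
    binomSum m A R t = binomSum m A S t :=
  Finset.sum_congr rfl fun i hi => by rw [h i (by simpa [Nat.lt_succ_iff] using hi)]

theorem binomSum_mul_right {M N : ℕ} (m : ℕ) (A : ℝ → Matrix (Fin M) (Fin N) ℝ)
    (R : ℕ → Matrix (Fin N) (Fin N) ℝ) (X : Matrix (Fin N) (Fin N) ℝ) (t : ℝ) :
    binomSum m A (fun i => R i * X) t = binomSum m A R t * X := by
  simp only [binomSum, Matrix.sum_mul, Matrix.smul_mul, Matrix.mul_assoc]

theorem binomSum_const_mul {L M N : ℕ} (T : Matrix (Fin L) (Fin M) ℝ) (m : ℕ)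
    {A : ℝ → Matrix (Fin M) (Fin N) ℝ} (hA : MatSmooth A)
    (R : ℕ → Matrix (Fin N) (Fin N) ℝ) (t : ℝ) :
    binomSum m (fun s => T * A s) R t = T * binomSum m A R t := by
  simp only [binomSum, Matrix.mul_sum, Matrix.mul_smul, Matrix.mul_assoc, dmat_const_mul T hA]

theorem binomSum_mul {M N : ℕ} (m : ℕ) {A : ℝ → Matrix (Fin M) (Fin N) ℝ}
    {X : ℝ → Matrix (Fin N) (Fin N) ℝ} (hA : MatSmooth A) (hX : MatSmooth X)
    (R : ℕ → Matrix (Fin N) (Fin N) ℝ) (t : ℝ) :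
    binomSum m (fun s => A s * X s) R t = binomSum m A (fun r => binomSum r X R t) t := by
  simp only [binomSum, dmat_mul hA hX, Matrix.sum_mul, Matrix.mul_sum, Finset.smul_sum,
    Matrix.smul_mul, Matrix.mul_smul, smul_smul, Matrix.mul_assoc]
  rw [Finset.sum_sigma', Finset.sum_sigma']
  refine Finset.sum_bij' (fun p _ => ⟨m - p.2, p.1⟩) (fun p _ => ⟨p.2, m - p.1⟩) ?_ ?_ ?_ ?_ ?_
  · rintro ⟨i, j⟩ h
    simp at h ⊢
    omega
  · rintro ⟨i, j⟩ h
    simp at h ⊢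
    omega
  · rintro ⟨i, j⟩ h
    simp at h ⊢
    omega
  · rintro ⟨i, j⟩ h
    simp at h ⊢
    omega
  · rintro ⟨i, j⟩ h
    simp only [Finset.mem_sigma, Finset.mem_range] at h ⊢
    have h1 : m - (m - j) = j := by omega
    have h2 : m - i - j = m - j - i := by omega
    have h3 : m.choose i * (m - i).choose j = m.choose (m - j) * (m - j).choose i := by
      rw [Nat.choose_mul (by omega : i ≤ m - j), ← h2,
        Nat.choose_symm (n := m - i) (by omega)]
    rw [h1, h2]
    congr 1
    exact_mod_cast h3

/-- The coefficients in a binomial relation of order `k` are determined by the leading one. -/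
theorem eq_of_binomSum_eq {k n : ℕ} {A : ℝ → Matrix (Fin (k * n)) (Fin n) ℝ} {t : ℝ}
    (hA : IsUnit (frameMat k n A t)) {R S : ℕ → Matrix (Fin n) (Fin n) ℝ} (h0 : R 0 = S 0)
    (h : binomSum k A R t = binomSum k A S t) {i : ℕ} (hi : i ≤ k) : R i = S i := by
  rcases Nat.eq_zero_or_pos i with rfl | hpos
  · exact h0
  rw [← sub_eq_zero, binomSum, binomSum, ← Finset.sum_sub_distrib, ← Finset.sum_range_reflect,
    Finset.sum_range_succ] at h
  simp only [← smul_sub, ← Matrix.mul_sub, ← Matrix.mul_smul] at h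
  have hlast : k + 1 - 1 - k = 0 := by omega
  rw [hlast, h0, sub_self, smul_zero, Matrix.mul_zero, add_zero] at h
  have hM := eq_zero_of_sum_dmat_mul_eq_zero hA
    (fun j => (k.choose (k - j) : ℝ) • (R (k - j) - S (k - j)))
    (Eq.trans (Finset.sum_congr rfl fun j hj => by
      have := Finset.mem_range.1 hj
      rw [show k + 1 - 1 - j = k - j by omega, show k - (k - j) = j by omega]) h)
    (i := k - i) (by omega)
  rw [show k - (k - i) = i by omega] at hM
  rcases smul_eq_zero.1 hM with h' | h'
  · exact absurd (by exact_mod_cast h') (Nat.choose_pos hi).ne'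
  · exact sub_eq_zero.1 h'

/-- Equivariance of the horizontal derivative
`H = A^{(k-1)} + ∑_{i=1}^{k-1} C(k-1,i) A^{(k-1-i)} P_i`. -/
theorem stmt_9 (k n : ℕ) (hk : 2 ≤ k) (hn : 1 ≤ n)
    (A : ℝ → Matrix (Fin (k * n)) (Fin n) ℝ) (hA : IsFanning k n A)
    (P : ℕ → ℝ → Matrix (Fin n) (Fin n) ℝ) (hP : IsCoeffs k n A P) :
    (∀ X : ℝ → Matrix (Fin n) (Fin n) ℝ, MatSmooth X → (∀ t, IsUnit (X t)) →
      IsFanning k n (fun t => A t * X t) ∧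
      ∀ Q : ℕ → ℝ → Matrix (Fin n) (Fin n) ℝ,
        IsCoeffs k n (fun t => A t * X t) Q →
        ∀ t, horDer k n (fun s => A s * X s) Q t = horDer k n A P t * X t) ∧
    (∀ T : Matrix (Fin (k * n)) (Fin (k * n)) ℝ, IsUnit T →
      IsFanning k n (fun t => T * A t) ∧
      ∀ Q : ℕ → ℝ → Matrix (Fin n) (Fin n) ℝ,
        IsCoeffs k n (fun t => T * A t) Q →
        ∀ t, horDer k n (fun s => T * A s) Q t = T * horDer k n A P t) := by
  have hP' : ∀ t, binomSum k A (Function.update (fun i => P i t) 0 1) t = 0 := fun t =>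
    (dmat_add_sum_eq_binomSum k A P t).symm.trans (hP.2 t)
  refine ⟨fun X hX hu => ⟨hA.mul_right hX hu, fun Q hQ t => ?_⟩,
    fun T hT => ⟨hA.const_mul hT, fun Q hQ t => ?_⟩⟩
  · have hQ' := (dmat_add_sum_eq_binomSum k _ Q t).symm.trans (hQ.2 t)
    rw [binomSum_mul k hA.1 hX] at hQ'
    rw [horDer, horDer, dmat_add_sum_eq_binomSum, dmat_add_sum_eq_binomSum,
      binomSum_mul _ hA.1 hX, ← binomSum_mul_right]
    refine binomSum_congr A t fun i hi => ?_
    refine eq_of_binomSum_eq (hA.2 t) (R := fun r => binomSum r X _ t)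
      (S := fun i => Function.update (fun i => P i t) 0 1 i * X t) ?_ ?_ (by omega)
    · simp [binomSum, dmat]
    · rw [hQ', binomSum_mul_right, hP', Matrix.zero_mul]
  · have hQ' := (dmat_add_sum_eq_binomSum k _ Q t).symm.trans (hQ.2 t)
    rw [binomSum_const_mul T k hA.1] at hQ'
    rw [horDer, horDer, dmat_add_sum_eq_binomSum, dmat_add_sum_eq_binomSum,
      binomSum_const_mul T _ hA.1]
    refine congrArg (fun B : Matrix (Fin (k * n)) (Fin n) ℝ => T * B) (binomSum_congr A t fun i hi => ?_)
    refine eq_of_binomSum_eq (hA.2 t) (by simp) ?_ (show i ≤ k by omega)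
    rw [hP']
    have hz := congrArg (fun B : Matrix (Fin (k * n)) (Fin n) ℝ => T⁻¹ * B) hQ'
    simpa [Matrix.nonsing_inv_mul_cancel_left _ _ ((Matrix.isUnit_iff_isUnit_det _).1 hT)]
      using hz
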